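/- Let N be a positive integer, ι a finite index type, and for each j : ι let H_j be a finite-dimensional complex inner product space carrying a unitary representation U_j of ZMod N with spectral projections P_j. Then for every family of states ψ with ψ j : H_j and every E : ZMod N, the following identity holds in the tensor product ⨂_{j : ι} H_j: (1/N) • ∑_{t : ZMod N} conj(χ_E(t)) • (⨂_{j} U_j(t)(ψ j)) = ∑_{c : ι → ZMod N, ∑_j c(j) = E} ⨂_{j} P_j(c(j))(ψ j). (Fixing the total energy E of a synchronised family yields the superposition over all distributions of individual energies summing to E.) -/

import Mathlib

open scoped BigOperators InnerProductSpace TensorProduct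

/-- The multiplicative characters (energy levels) of `ZMod N`. -/
noncomputable def chi (N : ℕ) (E t : ZMod N) : ℂ :=
  Complex.exp (2 * Real.pi * Complex.I * (E.val * t.val) / N)

/-- `chi` is the standard additive character evaluated at the product. -/
lemma chi_eq_stdAddChar (N : ℕ) [NeZero N] (E t : ZMod N) :
    chi N E t = ZMod.stdAddChar (E * t) := by
  have h := ZMod.stdAddChar_coe (N := N) ((E.val * t.val : ℕ) : ℤ)
  push_cast [ZMod.natCast_zmod_val] at h
  rw [h, chi]

/-- A product of characters in the same argument is the character of the sum. -/
lemma prod_chi {N : ℕ} [NeZero N] {ι : Type*} [Fintype ι] (c : ι → ZMod N) (t : ZMod N) :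
    ∏ j, chi N (c j) t = chi N (∑ j, c j) t := by
  simp only [chi_eq_stdAddChar, Finset.sum_mul]
  exact (map_prod (ZMod.stdAddChar (N := N)).toMonoidHom
    (fun j => Multiplicative.ofAdd (c j * t)) Finset.univ).symm

/-- Orthogonality of the characters of `ZMod N`. -/
lemma sum_conj_chi_mul_chi {N : ℕ} [NeZero N] (E F : ZMod N) :
    ∑ t : ZMod N, (starRingEnd ℂ) (chi N E t) * chi N F t = if F = E then (N : ℂ) else 0 := by
  have h := AddChar.sum_mulShift (F - E) (ZMod.isPrimitive_stdAddChar N)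
  simp only [sub_eq_zero, ZMod.card] at h
  rw [Nat.cast_ite, Nat.cast_zero] at h
  rw [← h]
  refine Finset.sum_congr rfl fun t _ => ?_
  rw [chi_eq_stdAddChar, chi_eq_stdAddChar, ← AddChar.map_neg_eq_conj, ← AddChar.map_add_eq_mul]
  congr 1
  ring

/-- Fixing the total energy `E` of a family of systems synchronised with a common clock
yields the superposition over all distributions of individual energies summing to `E`. -/
theorem synchronised_family_total_energy
    (N : ℕ) [NeZero N] {ι : Type*} [Fintype ι] [DecidableEq ι]
    {H : ι → Type*} [∀ j, NormedAddCommGroup (H j)] [∀ j, InnerProductSpace ℂ (H j)]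
    [∀ j, FiniteDimensional ℂ (H j)]
    (U : ∀ j, ZMod N → (H j →L[ℂ] H j))
    (hU0 : ∀ j, U j 0 = 1)
    (hUadd : ∀ j, ∀ s t : ZMod N, U j (s + t) = U j s ∘L U j t)
    (hUunitary : ∀ j, ∀ (t : ZMod N) (v w : H j), ⟪U j t v, U j t w⟫_ℂ = ⟪v, w⟫_ℂ)
    (P : ∀ j, ZMod N → (H j →L[ℂ] H j))
    (hPsa : ∀ j E, IsSelfAdjoint (P j E))
    (hPidem : ∀ j E, P j E ∘L P j E = P j E)
    (hPorth : ∀ j, ∀ E E' : ZMod N, E ≠ E' → P j E ∘L P j E' = 0)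
    (hPsum : ∀ j, (∑ E : ZMod N, P j E) = 1)
    (hUP : ∀ j, ∀ t : ZMod N, U j t = ∑ E : ZMod N, chi N E t • P j E)
    (ψ : ∀ j, H j) (E : ZMod N) :
    (1 / (N : ℂ)) •
        ∑ t : ZMod N, (starRingEnd ℂ) (chi N E t) • (⨂ₜ[ℂ] j, U j t (ψ j))
      = ∑ c ∈ Finset.univ.filter (fun c : ι → ZMod N => (∑ j, c j) = E),
          ⨂ₜ[ℂ] j, P j (c j) (ψ j) := by
  have expand (t : ZMod N) : (⨂ₜ[ℂ] j, U j t (ψ j)) =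
      ∑ c : ι → ZMod N, chi N (∑ j, c j) t • ⨂ₜ[ℂ] j, P j (c j) (ψ j) := by
    simp only [hUP, sum_apply, smul_apply]
    rw [MultilinearMap.map_sum]
    simp only [MultilinearMap.map_smul_univ, prod_chi]
  simp only [expand, Finset.smul_sum, smul_smul]
  rw [Finset.sum_comm, Finset.sum_filter]
  refine Finset.sum_congr rfl fun c _ => ?_
  rw [← Finset.sum_smul, ← Finset.mul_sum, sum_conj_chi_mul_chi]
  split_ifs
  · rw [one_div, inv_mul_cancel₀ (NeZero.ne (N : ℂ)), one_smul]
  · rw [mul_zero, zero_smul]
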